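/- If base sequences BS(r,s) exist, then T-sequences of length r+s exist. -/

import Mathlib

open Finset Matrix Kronecker

/-- Nonperiodic autocorrelation `N_X(j)` of a sequence of length `m` (0-indexed):
`N_X(j) = ∑_{k=0}^{m-j-1} x_k x_{k+j}`. -/
def autocorr (m : ℕ) (X : ℕ → ℤ) (j : ℕ) : ℤ :=
  ∑ k ∈ Finset.range (m - j), X k * X (k + j)

/-- A binary (±1) sequence of length `m`. -/
def IsBinarySeq (m : ℕ) (X : ℕ → ℤ) : Prop :=
  ∀ i < m, X i = 1 ∨ X i = -1

/-- Base sequences `BS(r,s)`: binary sequences `A, B` of length `r` and `C, D` of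
length `s` whose nonperiodic autocorrelations sum to zero for all `j ≥ 1`. -/
def IsBaseSeq (r s : ℕ) (A B C D : ℕ → ℤ) : Prop :=
  IsBinarySeq r A ∧ IsBinarySeq r B ∧ IsBinarySeq s C ∧ IsBinarySeq s D ∧
    ∀ j, 1 ≤ j →
      autocorr r A j + autocorr r B j + autocorr s C j + autocorr s D j = 0

/-- A Golay pair of length `g`. -/
def IsGolayPair (g : ℕ) (A B : ℕ → ℤ) : Prop :=
  IsBinarySeq g A ∧ IsBinarySeq g B ∧
    ∀ j, 1 ≤ j → autocorr g A j + autocorr g B j = 0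

/-- Normal sequences `NS(n)`: base sequences in `BS(n+1,n)` whose first two
sequences agree in the first `n` entries. -/
def IsNormalSeq (n : ℕ) (A B C D : ℕ → ℤ) : Prop :=
  IsBaseSeq (n + 1) n A B C D ∧ ∀ i < n, B i = A i

/-- Near-normal sequences `NN(n)`: base sequences in `BS(n+1,n)` with
`b_i = (-1)^(i-1) a_i` for `i = 1, …, n` (0-indexed: `B i = (-1)^i * A i`). -/
def IsNearNormalSeq (n : ℕ) (A B C D : ℕ → ℤ) : Prop :=
  IsBaseSeq (n + 1) n A B C D ∧ ∀ i < n, B i = (-1) ^ i * A i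

/-- T-sequences of length `t`: four `{-1,0,1}`-sequences such that at every
position exactly one of them is nonzero, and the sum of their nonperiodic
autocorrelations vanishes for all `j ≥ 1`. -/
def IsTSeq (t : ℕ) (T₁ T₂ T₃ T₄ : ℕ → ℤ) : Prop :=
  (∀ i < t, T₁ i ∈ ({-1, 0, 1} : Set ℤ)) ∧
  (∀ i < t, T₂ i ∈ ({-1, 0, 1} : Set ℤ)) ∧
  (∀ i < t, T₃ i ∈ ({-1, 0, 1} : Set ℤ)) ∧
  (∀ i < t, T₄ i ∈ ({-1, 0, 1} : Set ℤ)) ∧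
  (∀ i < t,
    (T₁ i ≠ 0 ∧ T₂ i = 0 ∧ T₃ i = 0 ∧ T₄ i = 0) ∨
    (T₁ i = 0 ∧ T₂ i ≠ 0 ∧ T₃ i = 0 ∧ T₄ i = 0) ∨
    (T₁ i = 0 ∧ T₂ i = 0 ∧ T₃ i ≠ 0 ∧ T₄ i = 0) ∨
    (T₁ i = 0 ∧ T₂ i = 0 ∧ T₃ i = 0 ∧ T₄ i ≠ 0)) ∧
  ∀ j, 1 ≤ j →
    autocorr t T₁ j + autocorr t T₂ j + autocorr t T₃ j + autocorr t T₄ j = 0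

/-- An orthogonal design `OD(4d; d,d,d,d)`: four `4d × 4d` matrices with entries
in `{-1,0,1}`, pairwise disjoint supports covering every position, with
`Aᵢ Aᵢᵀ = d·I` and `Aᵢ Aⱼᵀ + Aⱼ Aᵢᵀ = 0` for `i ≠ j`. -/
def IsOD (d : ℕ) (A : Fin 4 → Matrix (Fin (4 * d)) (Fin (4 * d)) ℤ) : Prop :=
  (∀ k i j, A k i j ∈ ({-1, 0, 1} : Set ℤ)) ∧
  (∀ i j, ∃! k : Fin 4, A k i j ≠ 0) ∧
  (∀ k, A k * (A k)ᵀ = (d : ℤ) • 1) ∧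
  (∀ k l, k ≠ l → A k * (A l)ᵀ + A l * (A k)ᵀ = 0)

/-- Williamson-type matrices of order `w`: four pairwise amicable `±1` matrices
with `∑ Wᵢ Wᵢᵀ = 4w·I`. -/
def IsWilliamsonType (w : ℕ) (W : Fin 4 → Matrix (Fin w) (Fin w) ℤ) : Prop :=
  (∀ k i j, W k i j = 1 ∨ W k i j = -1) ∧
  (∀ k l, W k * (W l)ᵀ = W l * (W k)ᵀ) ∧
  (∑ k, W k * (W k)ᵀ) = ((4 * w : ℕ) : ℤ) • 1

/-- A Hadamard matrix: a `±1` matrix `H` with `H Hᵀ = m·I`, where `m` is the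
size of the (finite) index type. -/
def IsHadamardMatrix {n : Type*} [Fintype n] [DecidableEq n] (H : Matrix n n ℤ) : Prop :=
  (∀ i j, H i j = 1 ∨ H i j = -1) ∧ H * Hᵀ = (Fintype.card n : ℤ) • 1

theorem autocorr_eq_of_eq_zero_of_le {m t : ℕ} {X : ℕ → ℤ} (hmt : m ≤ t)
    (hX : ∀ i, m ≤ i → X i = 0) (j : ℕ) : autocorr t X j = autocorr m X j := by
  unfold autocorr
  refine (Finset.sum_subset (Finset.range_mono (by omega)) fun k _ hk => ?_).symm
  rw [Finset.mem_range] at hk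
  rw [hX (k + j) (by omega), mul_zero]

theorem autocorr_add_eq_of_eq_zero_of_lt {r : ℕ} {X : ℕ → ℤ} (s : ℕ)
    (hX : ∀ i < r, X i = 0) (j : ℕ) :
    autocorr (r + s) X j = autocorr s (fun i => X (r + i)) j := by
  unfold autocorr
  rcases le_total j s with hj | hj
  · rw [Nat.add_sub_assoc hj, Finset.sum_range_add,
      Finset.sum_eq_zero fun k hk => by rw [hX k (Finset.mem_range.mp hk), zero_mul], zero_add]
    simp only [add_assoc]
  · rw [Nat.sub_eq_zero_of_le hj, Finset.range_zero, Finset.sum_empty]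
    refine Finset.sum_eq_zero fun k hk => ?_
    rw [Finset.mem_range] at hk
    rw [hX k (by omega), zero_mul]

theorem autocorr_congr {m : ℕ} {X Y : ℕ → ℤ} (h : ∀ i < m, X i = Y i) (j : ℕ) :
    autocorr m X j = autocorr m Y j := by
  refine Finset.sum_congr rfl fun k hk => ?_
  rw [Finset.mem_range] at hk
  rw [h k (by omega), h (k + j) (by omega)]

theorem two_mul_autocorr_half_add_half_sub {m : ℕ} {A B : ℕ → ℤ} (hA : IsBinarySeq m A)
    (hB : IsBinarySeq m B) (j : ℕ) :
    2 * (autocorr m (fun i => (A i + B i) / 2) j + autocorr m (fun i => (A i - B i) / 2) j) =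
      autocorr m A j + autocorr m B j := by
  unfold autocorr
  rw [← Finset.sum_add_distrib, ← Finset.sum_add_distrib, Finset.mul_sum]
  refine Finset.sum_congr rfl fun k hk => ?_
  rw [Finset.mem_range] at hk
  rcases hA k (by omega) with h₁ | h₁ <;> rcases hB k (by omega) with h₂ | h₂ <;>
    rcases hA (k + j) (by omega) with h₃ | h₃ <;> rcases hB (k + j) (by omega) with h₄ | h₄ <;>
    norm_num [h₁, h₂, h₃, h₄]

/-- If base sequences `BS(r,s)` exist, then T-sequences of
length `r + s` exist. -/
theorem base_seq_exists_to_T_seq_exists (r s : ℕ)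
    (h : ∃ A B C D : ℕ → ℤ, IsBaseSeq r s A B C D) :
    ∃ T₁ T₂ T₃ T₄ : ℕ → ℤ, IsTSeq (r + s) T₁ T₂ T₃ T₄ := by
  obtain ⟨A, B, C, D, hA, hB, hC, hD, hN⟩ := h
  have values : ∀ i < r + s,
      (i < r ∧ (A i = 1 ∨ A i = -1) ∧ (B i = 1 ∨ B i = -1)) ∨
      (¬ i < r ∧ (C (i - r) = 1 ∨ C (i - r) = -1) ∧ (D (i - r) = 1 ∨ D (i - r) = -1)) := by
    intro i hi
    by_cases hir : i < r
    · exact .inl ⟨hir, hA i hir, hB i hir⟩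
    · exact .inr ⟨hir, hC _ (by omega), hD _ (by omega)⟩
  refine ⟨fun i => if i < r then (A i + B i) / 2 else 0,
    fun i => if i < r then (A i - B i) / 2 else 0,
    fun i => if i < r then 0 else (C (i - r) + D (i - r)) / 2,
    fun i => if i < r then 0 else (C (i - r) - D (i - r)) / 2, ?_, ?_, ?_, ?_, ?_, ?_⟩
  iterate 5
    · intro i hi
      rcases values i hi with ⟨hir, h₁ | h₁, h₂ | h₂⟩ | ⟨hir, h₁ | h₁, h₂ | h₂⟩ <;>
        norm_num [hir, h₁, h₂]
  · intro j hj
    have left (f : ℕ → ℤ) :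
        autocorr (r + s) (fun i => if i < r then f i else 0) j = autocorr r f j := by
      rw [autocorr_eq_of_eq_zero_of_le (Nat.le_add_right r s) fun i hi => if_neg (by omega)]
      exact autocorr_congr (fun i hi => if_pos hi) j
    have right (f : ℕ → ℤ) :
        autocorr (r + s) (fun i => if i < r then 0 else f (i - r)) j = autocorr s f j := by
      rw [autocorr_add_eq_of_eq_zero_of_lt s fun i hi => if_pos hi]
      simp
    rw [left fun i => (A i + B i) / 2, left fun i => (A i - B i) / 2,
      right fun i => (C i + D i) / 2, right fun i => (C i - D i) / 2]
    linarith [hN j hj, two_mul_autocorr_half_add_half_sub hA hB j,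
      two_mul_autocorr_half_add_half_sub hC hD j]
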